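/- Let 2 < p < 14/3. For all A ∈ ℝ and B > 0 there exists K > 0 such that every Schwartz function u : ℝ² → ℂ with E(u) ≤ A and M(u) ≤ B satisfies X(u) + Y(u) ≤ K (a priori bound on the anisotropic kinetic energy in the mass-subcritical regime). -/

import Mathlib

open MeasureTheory

noncomputable section

/-- Partial derivative in the first (x) variable. -/
def pdx (u : ℝ × ℝ → ℂ) : ℝ × ℝ → ℂ := fun z => deriv (fun x => u (x, z.2)) z.1

/-- Partial derivative in the second (y) variable. -/
def pdy (u : ℝ × ℝ → ℂ) : ℝ × ℝ → ℂ := fun z => deriv (fun y => u (z.1, y)) z.2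

/-- Second partial derivative in x. -/
def pdxx (u : ℝ × ℝ → ℂ) : ℝ × ℝ → ℂ := pdx (pdx u)

/-- Second partial derivative in y. -/
def pdyy (u : ℝ × ℝ → ℂ) : ℝ × ℝ → ℂ := pdy (pdy u)

/-- Fourth partial derivative in y. -/
def pdyyyy (u : ℝ × ℝ → ℂ) : ℝ × ℝ → ℂ := pdy (pdy (pdy (pdy u)))

/-- X(u) = ∫ |∂ₓ u|². -/
def Xf (u : ℝ × ℝ → ℂ) : ℝ := ∫ z : ℝ × ℝ, ‖pdx u z‖ ^ 2

/-- Y(u) = ∫ |∂_yy u|². -/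
def Yf (u : ℝ × ℝ → ℂ) : ℝ := ∫ z : ℝ × ℝ, ‖pdyy u z‖ ^ 2

/-- M(u) = ∫ |u|². -/
def Mf (u : ℝ × ℝ → ℂ) : ℝ := ∫ z : ℝ × ℝ, ‖u z‖ ^ 2

/-- P(u) = ∫ |u|ᵖ. -/
def Pf (p : ℝ) (u : ℝ × ℝ → ℂ) : ℝ := ∫ z : ℝ × ℝ, ‖u z‖ ^ p

/-- Energy E(u) = X(u)/2 + Y(u)/2 − P(u)/p. -/
def Ef (p : ℝ) (u : ℝ × ℝ → ℂ) : ℝ := Xf u / 2 + Yf u / 2 - Pf p u / p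

/-- Action J_ω(u) = X(u)/2 + Y(u)/2 + (ω/2) M(u) − P(u)/p. -/
def Jf (p ω : ℝ) (u : ℝ × ℝ → ℂ) : ℝ := Xf u / 2 + Yf u / 2 + ω / 2 * Mf u - Pf p u / p

/-- Standing wave equation −∂ₓₓu + ∂_yyyy u + ω u = |u|^{p−2} u pointwise. -/
def IsStandingWave (p ω : ℝ) (u : ℝ × ℝ → ℂ) : Prop :=
  ∀ z : ℝ × ℝ, -pdxx u z + pdyyyy u z + (ω : ℂ) * u z = ((‖u z‖ ^ (p - 2) : ℝ) : ℂ) * u z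

/-- Mass-preserving anisotropic scaling u_λ(x,y) = λ^{3/8} u(λ^{1/2} x, λ^{1/4} y). -/
def uscale (l : ℝ) (u : ℝ × ℝ → ℂ) : ℝ × ℝ → ℂ :=
  fun z => ((l ^ ((3 : ℝ) / 8) : ℝ) : ℂ) * u (l ^ ((1 : ℝ) / 2) * z.1, l ^ ((1 : ℝ) / 4) * z.2)

end

section AnisotropicGagliardoNirenberg

open Filter Set Topology
open scoped ENNReal LineDeriv SchwartzMap

/-- A function vanishing at `-∞` is bounded by the integral of any bound of its derivative. -/
theorem ofReal_le_lintegral_of_hasDerivAt_le {g g' b : ℝ → ℝ}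
    (hg : ∀ x, HasDerivAt g (g' x) x) (hb : Continuous b) (hgb : ∀ x, g' x ≤ b x)
    (hb0 : ∀ x, 0 ≤ b x) (h0 : Tendsto g atBot (𝓝 0)) (x : ℝ) :
    ENNReal.ofReal (g x) ≤ ∫⁻ s, ENNReal.ofReal (b s) := by
  have hlim : Tendsto (fun a => ENNReal.ofReal (g x - g a)) atBot (𝓝 (ENNReal.ofReal (g x))) := by
    simpa using ENNReal.tendsto_ofReal (tendsto_const_nhds.sub h0 : Tendsto _ _ (𝓝 (g x - 0)))
  refine le_of_tendsto hlim ?_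
  filter_upwards [eventually_le_atBot x] with a ha
  have h1 : g x - g a ≤ ∫ y in a..x, b y :=
    intervalIntegral.sub_le_integral_of_hasDeriv_right_of_le ha
      (fun y _ => (hg y).continuousAt.continuousWithinAt)
      (fun y _ => (hg y).hasDerivWithinAt) hb.continuousOn.integrableOn_Icc (fun y _ => hgb y)
  rw [intervalIntegral.integral_of_le ha] at h1
  calc ENNReal.ofReal (g x - g a) ≤ ENNReal.ofReal (∫ y in Ioc a x, b y) :=
        ENNReal.ofReal_le_ofReal h1
    _ = ∫⁻ y in Ioc a x, ENNReal.ofReal (b y) :=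
        ofReal_integral_eq_lintegral_ofReal
          (hb.continuousOn.integrableOn_Icc.mono_set Ioc_subset_Icc_self) (ae_of_all _ hb0)
    _ ≤ ∫⁻ y, ENNReal.ofReal (b y) := setLIntegral_le_lintegral _ _

theorem ofReal_norm_sq_le_lintegral {f f' : ℝ → ℂ} (hf : ∀ x, HasDerivAt f (f' x) x)
    (hf' : Continuous f') (h0 : Tendsto f atBot (𝓝 0)) (x : ℝ) :
    ENNReal.ofReal (‖f x‖ ^ 2) ≤ ∫⁻ s, ENNReal.ofReal (2 * (‖f s‖ * ‖f' s‖)) := by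
  have hc : Continuous f := continuous_iff_continuousAt.2 fun x => (hf x).continuousAt
  refine ofReal_le_lintegral_of_hasDerivAt_le (g := fun x => ‖f x‖ ^ 2)
    (fun x => (hf x).norm_sq) (by fun_prop) (fun x => ?_) (fun x => by positivity)
    (by simpa using (h0.norm.pow 2)) x
  gcongr
  exact real_inner_le_norm _ _

theorem ofReal_norm_pow_four_le_lintegral {f f' : ℝ → ℂ} (hf : ∀ x, HasDerivAt f (f' x) x)
    (hf' : Continuous f') (h0 : Tendsto f atBot (𝓝 0)) (x : ℝ) :
    ENNReal.ofReal (‖f x‖ ^ 4) ≤ ∫⁻ s, ENNReal.ofReal (4 * (‖f s‖ ^ 3 * ‖f' s‖)) := by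
  have hc : Continuous f := continuous_iff_continuousAt.2 fun x => (hf x).continuousAt
  refine ofReal_le_lintegral_of_hasDerivAt_le (g := fun x => ‖f x‖ ^ 4)
    (g' := fun x => 4 * ‖f x‖ ^ 2 * inner ℝ (f x) (f' x)) (fun x => ?_) (by fun_prop)
    (fun x => ?_) (fun x => by positivity) (by simpa using (h0.norm.pow 4)) x
  · convert! (hf x).norm_sq.pow 2 using 1
    · ext y; simp only [Pi.pow_apply]; ring
    · simp; ring
  · calc 4 * ‖f x‖ ^ 2 * inner ℝ (f x) (f' x) ≤ 4 * ‖f x‖ ^ 2 * (‖f x‖ * ‖f' x‖) := by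
          gcongr; exact real_inner_le_norm _ _
      _ = _ := by ring

/-- If `F` is bounded by a horizontal line integral and `H` by a vertical one, the integral of
`F * H` is at most the product of the corresponding plane integrals. -/
theorem lintegral_mul_le_of_le_lintegral_slices {F H F' H' : ℝ × ℝ → ℝ≥0∞}
    (hF' : Measurable F') (hH' : Measurable H')
    (hF : ∀ x y, F (x, y) ≤ ∫⁻ s, F' (s, y)) (hH : ∀ x y, H (x, y) ≤ ∫⁻ t, H' (x, t)) :
    ∫⁻ z, F z * H z ≤ (∫⁻ z, F' z) * ∫⁻ z, H' z := by
  calc ∫⁻ z, F z * H z ≤ ∫⁻ z : ℝ × ℝ, (∫⁻ t, H' (z.1, t)) * ∫⁻ s, F' (s, z.2) :=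
        lintegral_mono fun z => by
          rw [mul_comm]; exact mul_le_mul' (hH z.1 z.2) (hF z.1 z.2)
    _ = (∫⁻ x, ∫⁻ t, H' (x, t)) * ∫⁻ y, ∫⁻ s, F' (s, y) :=
        lintegral_prod_mul hH'.lintegral_prod_right'.aemeasurable
          hF'.lintegral_prod_left'.aemeasurable
    _ = _ := by
        rw [mul_comm, Measure.volume_eq_prod, lintegral_prod_symm' _ hF', lintegral_prod _
          hH'.aemeasurable]

theorem integral_mul_sq_le {α : Type*} [MeasurableSpace α] {μ : Measure α} {f g : α → ℝ}
    (hf0 : ∀ x, 0 ≤ f x) (hg0 : ∀ x, 0 ≤ g x) (hf : MemLp f 2 μ) (hg : MemLp g 2 μ) :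
    (∫ x, f x * g x ∂μ) ^ 2 ≤ (∫ x, f x ^ 2 ∂μ) * ∫ x, g x ^ 2 ∂μ := by
  have h := integral_mul_le_Lp_mul_Lq_of_nonneg (μ := μ) Real.HolderConjugate.two_two
    (ae_of_all _ hf0) (ae_of_all _ hg0) (by simpa using hf) (by simpa using hg)
  have hF : 0 ≤ ∫ x, f x ^ 2 ∂μ := integral_nonneg fun x => by positivity
  have hG : 0 ≤ ∫ x, g x ^ 2 ∂μ := integral_nonneg fun x => by positivity
  have hfg : 0 ≤ ∫ x, f x * g x ∂μ := integral_nonneg fun x => mul_nonneg (hf0 x) (hg0 x)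
  simp only [Real.rpow_two, ← Real.sqrt_eq_rpow] at h
  calc _ ≤ (√(∫ x, f x ^ 2 ∂μ) * √(∫ x, g x ^ 2 ∂μ)) ^ 2 := by gcongr
    _ = _ := by rw [mul_pow, Real.sq_sqrt hF, Real.sq_sqrt hG]

theorem SchwartzMap.memLp_norm_pow {D : Type*} [NormedAddCommGroup D] [NormedSpace ℝ D]
    [MeasurableSpace D] [BorelSpace D] [SecondCountableTopology D] {μ : Measure D}
    [μ.HasTemperateGrowth] (u : 𝓢(D, ℂ)) {n : ℕ} (hn : n ≠ 0) (q : ℝ≥0∞) :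
    MemLp (fun z => ‖u z‖ ^ n) q μ := by
  have h := (u.memLp (q * n) μ).norm_rpow_div (n : ℝ≥0∞)
  simpa [ENNReal.mul_div_cancel_right, hn] using h

theorem SchwartzMap.integrable_norm_pow (u : 𝓢(ℝ × ℝ, ℂ)) {n : ℕ} (hn : n ≠ 0) :
    Integrable (fun z => ‖u z‖ ^ n) :=
  memLp_one_iff_integrable.1 (u.memLp_norm_pow hn 1)

theorem SchwartzMap.hasDerivAt_fst (u : 𝓢(ℝ × ℝ, ℂ)) (x y : ℝ) :
    HasDerivAt (fun s => u (s, y)) (∂_{((1 : ℝ), (0 : ℝ))} u (x, y)) x :=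
  HasFDerivAt.comp_hasDerivAt x (u.hasFDerivAt (x, y))
    ((hasDerivAt_id x).prodMk (hasDerivAt_const x y))

theorem SchwartzMap.hasDerivAt_snd (u : 𝓢(ℝ × ℝ, ℂ)) (x y : ℝ) :
    HasDerivAt (fun t => u (x, t)) (∂_{((0 : ℝ), (1 : ℝ))} u (x, y)) y :=
  HasFDerivAt.comp_hasDerivAt y (u.hasFDerivAt (x, y))
    ((hasDerivAt_const y x).prodMk (hasDerivAt_id y))

theorem pdx_schwartzMap (u : 𝓢(ℝ × ℝ, ℂ)) :
    pdx (fun z => u z) = fun z => ∂_{((1 : ℝ), (0 : ℝ))} u z :=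
  funext fun z => (u.hasDerivAt_fst z.1 z.2).deriv

theorem pdy_schwartzMap (u : 𝓢(ℝ × ℝ, ℂ)) :
    pdy (fun z => u z) = fun z => ∂_{((0 : ℝ), (1 : ℝ))} u z :=
  funext fun z => (u.hasDerivAt_snd z.1 z.2).deriv

theorem SchwartzMap.tendsto_fst_atBot (u : 𝓢(ℝ × ℝ, ℂ)) (y : ℝ) :
    Tendsto (fun s => u (s, y)) atBot (𝓝 0) := by
  refine (u.toZeroAtInfty.zero_at_infty').comp ?_
  exact (Function.LeftInverse.isClosedEmbedding (f := Prod.fst) (fun _ => rfl) continuous_fst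
    (by fun_prop)).tendsto_cocompact.mono_left atBot_le_cocompact

theorem SchwartzMap.tendsto_snd_atBot (u : 𝓢(ℝ × ℝ, ℂ)) (x : ℝ) :
    Tendsto (fun t => u (x, t)) atBot (𝓝 0) := by
  refine (u.toZeroAtInfty.zero_at_infty').comp ?_
  exact (Function.LeftInverse.isClosedEmbedding (f := Prod.snd) (fun _ => rfl) continuous_snd
    (by fun_prop)).tendsto_cocompact.mono_left atBot_le_cocompact

/-- The interpolation inequality `‖∂_v u‖₂⁴ ≤ ‖u‖₂² ‖∂_v ∂_v u‖₂²`. -/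
theorem SchwartzMap.integral_norm_lineDeriv_sq_sq_le (u : 𝓢(ℝ × ℝ, ℂ)) (v : ℝ × ℝ) :
    (∫ z, ‖∂_{v} u z‖ ^ 2) ^ 2 ≤ (∫ z, ‖u z‖ ^ 2) * ∫ z, ‖∂_{v} (∂_{v} u) z‖ ^ 2 := by
  have hp : ∫ z, inner ℝ (∂_{v} u z) (∂_{v} u z) = -∫ z, inner ℝ (∂_{v} (∂_{v} u) z) (u z) :=
    SchwartzMap.integral_bilinear_lineDerivOp_right_eq_neg_left (∂_{v} u) u (innerSL ℝ) v
  simp only [real_inner_self_eq_norm_sq] at hp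
  have hi : Integrable fun z => ‖u z‖ * ‖∂_{v} (∂_{v} u) z‖ :=
    ((u.memLp 2).norm.integrable_mul ((∂_{v} (∂_{v} u)).memLp 2).norm)
  have hle : ∫ z, ‖∂_{v} u z‖ ^ 2 ≤ ∫ z, ‖u z‖ * ‖∂_{v} (∂_{v} u) z‖ := by
    rw [hp]
    refine (neg_le_abs _).trans ?_
    rw [← Real.norm_eq_abs]
    refine (norm_integral_le_integral_norm _).trans ?_
    refine integral_mono_of_nonneg (ae_of_all _ fun z => norm_nonneg _) hi
      (ae_of_all _ fun z => ?_)
    exact (norm_inner_le_norm _ _).trans_eq (mul_comm _ _)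
  have h0 : 0 ≤ ∫ z, ‖∂_{v} u z‖ ^ 2 := integral_nonneg fun z => by positivity
  calc _ ≤ (∫ z, ‖u z‖ * ‖∂_{v} (∂_{v} u) z‖) ^ 2 := by gcongr
    _ ≤ _ := integral_mul_sq_le (fun _ => norm_nonneg _) (fun _ => norm_nonneg _)
        (u.memLp 2).norm ((∂_{v} (∂_{v} u)).memLp 2).norm

theorem SchwartzMap.integral_norm_pow_six_le_mul (u : 𝓢(ℝ × ℝ, ℂ)) :
    ∫ z, ‖u z‖ ^ 6 ≤ (4 * ∫ z, ‖u z‖ ^ 3 * ‖∂_{((1 : ℝ), (0 : ℝ))} u z‖) *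
      (2 * ∫ z, ‖u z‖ * ‖∂_{((0 : ℝ), (1 : ℝ))} u z‖) := by
  set ux := ∂_{((1 : ℝ), (0 : ℝ))} u
  set uy := ∂_{((0 : ℝ), (1 : ℝ))} u
  have hcu := u.continuous
  have hcx := ux.continuous
  have hcy := uy.continuous
  have hi : Integrable fun z => 4 * (‖u z‖ ^ 3 * ‖ux z‖) :=
    ((u.memLp_norm_pow three_ne_zero 2).integrable_mul (ux.memLp 2).norm).const_mul 4
  have hj : Integrable fun z => 2 * (‖u z‖ * ‖uy z‖) :=
    ((u.memLp 2).norm.integrable_mul (uy.memLp 2).norm).const_mul 2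
  have key := lintegral_mul_le_of_le_lintegral_slices
    (F := fun z => ENNReal.ofReal (‖u z‖ ^ 4)) (H := fun z => ENNReal.ofReal (‖u z‖ ^ 2))
    (F' := fun z => ENNReal.ofReal (4 * (‖u z‖ ^ 3 * ‖ux z‖)))
    (H' := fun z => ENNReal.ofReal (2 * (‖u z‖ * ‖uy z‖)))
    (by fun_prop) (by fun_prop)
    (fun x y => ofReal_norm_pow_four_le_lintegral (fun s => u.hasDerivAt_fst s y)
      (by fun_prop) (u.tendsto_fst_atBot y) x)
    (fun x y => ofReal_norm_sq_le_lintegral (fun t => u.hasDerivAt_snd x t)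
      (by fun_prop) (u.tendsto_snd_atBot x) y)
  simp_rw [← ENNReal.ofReal_mul (pow_nonneg (norm_nonneg _) 4), ← pow_add] at key
  rw [← ofReal_integral_eq_lintegral_ofReal (u.integrable_norm_pow (by norm_num))
      (ae_of_all _ fun z => by positivity),
    ← ofReal_integral_eq_lintegral_ofReal hi (ae_of_all _ fun z => by positivity),
    ← ofReal_integral_eq_lintegral_ofReal hj (ae_of_all _ fun z => by positivity),
    ← ENNReal.ofReal_mul (integral_nonneg fun z => by positivity),
    integral_const_mul, integral_const_mul] at key
  refine (ENNReal.ofReal_le_ofReal_iff ?_).1 key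
  exact mul_nonneg (mul_nonneg (by norm_num) (integral_nonneg fun z => by positivity))
    (mul_nonneg (by norm_num) (integral_nonneg fun z => by positivity))

/-- The anisotropic Gagliardo–Nirenberg inequality at the exponent `6`. -/
theorem SchwartzMap.integral_norm_pow_six_le (u : 𝓢(ℝ × ℝ, ℂ)) :
    ∫ z, ‖u z‖ ^ 6 ≤ 64 * Xf (fun z => u z) * Mf (fun z => u z) *
      √(Mf (fun z => u z) * Yf (fun z => u z)) := by
  have key := u.integral_norm_pow_six_le_mul
  have hYZ := u.integral_norm_lineDeriv_sq_sq_le (0, 1)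
  have hX : Xf (fun z => u z) = ∫ z, ‖∂_{((1 : ℝ), (0 : ℝ))} u z‖ ^ 2 := by
    simp only [Xf, pdx_schwartzMap]
  have hY : Yf (fun z => u z) =
      ∫ z, ‖∂_{((0 : ℝ), (1 : ℝ))} (∂_{((0 : ℝ), (1 : ℝ))} u) z‖ ^ 2 := by
    simp only [Yf, pdyy, pdy_schwartzMap]
  have hM : Mf (fun z => u z) = ∫ z, ‖u z‖ ^ 2 := rfl
  rw [← hM, ← hY] at hYZ
  have hI := integral_mul_sq_le (fun z => pow_nonneg (norm_nonneg (u z)) 3)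
    (fun z => norm_nonneg (∂_{((1 : ℝ), (0 : ℝ))} u z))
    (u.memLp_norm_pow (μ := volume) three_ne_zero 2) ((∂_{((1 : ℝ), (0 : ℝ))} u).memLp 2).norm
  have hJ := integral_mul_sq_le (fun z => norm_nonneg (u z))
    (fun z => norm_nonneg (∂_{((0 : ℝ), (1 : ℝ))} u z))
    (u.memLp 2 volume).norm ((∂_{((0 : ℝ), (1 : ℝ))} u).memLp 2).norm
  simp_rw [← pow_mul] at hI
  norm_num only at hI
  rw [← hX] at hI
  rw [← hM] at hJ
  have hX0 : 0 ≤ Xf (fun z => u z) := integral_nonneg fun z => by positivity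
  have hM0 : 0 ≤ Mf (fun z => u z) := integral_nonneg fun z => by positivity
  have hP0 : 0 ≤ ∫ z, ‖u z‖ ^ 6 := integral_nonneg fun z => by positivity
  have hZ0 : 0 ≤ ∫ z, ‖∂_{((0 : ℝ), (1 : ℝ))} u z‖ ^ 2 := integral_nonneg fun z => by positivity
  generalize (∫ z, ‖u z‖ ^ 6) = P at *
  generalize (∫ z, ‖u z‖ ^ 3 * ‖∂_{((1 : ℝ), (0 : ℝ))} u z‖) = I at *
  generalize (∫ z, ‖u z‖ * ‖∂_{((0 : ℝ), (1 : ℝ))} u z‖) = J at *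
  generalize (∫ z, ‖∂_{((0 : ℝ), (1 : ℝ))} u z‖ ^ 2) = Z at *
  generalize Mf (fun z => u z) = M at *
  generalize Xf (fun z => u z) = X at *
  have hZ : Z ≤ √(M * Yf (fun z => u z)) := Real.le_sqrt_of_sq_le hYZ
  have hsq : P * P ≤ P * (64 * X * M * Z) := by
    calc P * P = P ^ 2 := by ring
      _ ≤ (4 * I * (2 * J)) ^ 2 := by gcongr
      _ = 64 * (I ^ 2 * J ^ 2) := by ring
      _ ≤ 64 * ((P * X) * (M * Z)) := by gcongr
      _ = _ := by ring
  have hPZ : P ≤ 64 * X * M * Z := by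
    rcases hP0.eq_or_lt with h | h
    · rw [← h]; positivity
    · exact le_of_mul_le_mul_left hsq h
  exact hPZ.trans (by gcongr)

theorem rpow_le_rpow_mul_sq_add_rpow_mul_pow_six {p R t : ℝ} (hp1 : 2 < p) (hp2 : p < 6)
    (hR : 0 < R) (ht : 0 ≤ t) :
    t ^ p ≤ R ^ (p - 2) * t ^ 2 + R ^ (p - 6) * t ^ 6 := by
  rcases ht.eq_or_lt with rfl | ht
  · simp [Real.zero_rpow (by linarith : p ≠ 0)]
  rcases le_total t R with h | h
  · have : t ^ p = t ^ (p - 2) * t ^ 2 := by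
      rw [← Real.rpow_natCast, ← Real.rpow_add ht]; norm_num
    have h2 : t ^ (p - 2) ≤ R ^ (p - 2) := Real.rpow_le_rpow ht.le h (by linarith)
    rw [this]
    have : t ^ (p - 2) * t ^ 2 ≤ R ^ (p - 2) * t ^ 2 := by gcongr
    have : 0 ≤ R ^ (p - 6) * t ^ 6 := by positivity
    linarith
  · have : t ^ p = t ^ (p - 6) * t ^ 6 := by
      rw [← Real.rpow_natCast, ← Real.rpow_add ht]; norm_num
    have h2 : t ^ (p - 6) ≤ R ^ (p - 6) := Real.rpow_le_rpow_of_nonpos hR h (by linarith)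
    rw [this]
    have : t ^ (p - 6) * t ^ 6 ≤ R ^ (p - 6) * t ^ 6 := by gcongr
    have : 0 ≤ R ^ (p - 2) * t ^ 2 := by positivity
    linarith

/-- The potential energy of a function of bounded mass grows at most like the power
`3 (p - 2) / 8` of its anisotropic kinetic energy. -/
theorem Pf_le_rpow {p B S : ℝ} (hp1 : 2 < p) (hp2 : p < 6) (hS : 0 < S)
    (u : 𝓢(ℝ × ℝ, ℂ)) (hM : Mf (fun z => u z) ≤ B) (hX : Xf (fun z => u z) ≤ S)
    (hY : Yf (fun z => u z) ≤ S) :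
    Pf p (fun z => u z) ≤ (B + 64 * B * √B) * S ^ (3 * (p - 2) / 8) := by
  have hX0 : 0 ≤ Xf (fun z => u z) := integral_nonneg fun z => by positivity
  have hM0 : 0 ≤ Mf (fun z => u z) := integral_nonneg fun z => by positivity
  have hY0 : 0 ≤ Yf (fun z => u z) := integral_nonneg fun z => by positivity
  have hB0 := hM0.trans hM
  set R := S ^ (3 / 8 : ℝ) with hRdef
  have hR : 0 < R := by positivity
  have h1 : Pf p (fun z => u z) ≤
      R ^ (p - 2) * Mf (fun z => u z) + R ^ (p - 6) * ∫ z, ‖u z‖ ^ 6 := by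
    have i2 := (u.integrable_norm_pow two_ne_zero).const_mul (R ^ (p - 2))
    have i6 := (u.integrable_norm_pow (n := 6) (by norm_num)).const_mul (R ^ (p - 6))
    rw [Mf, ← integral_const_mul, ← integral_const_mul, ← integral_add i2 i6]
    exact integral_mono_of_nonneg (ae_of_all _ fun z => by positivity) (i2.add i6)
      (ae_of_all _ fun z =>
        rpow_le_rpow_mul_sq_add_rpow_mul_pow_six hp1 hp2 hR (norm_nonneg (u z)))
  have h6 : ∫ z, ‖u z‖ ^ 6 ≤ 64 * S * B * √(B * S) :=
    u.integral_norm_pow_six_le.trans (by gcongr)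
  have e2 : R ^ (p - 2) = S ^ (3 * (p - 2) / 8) := by
    rw [hRdef, ← Real.rpow_mul hS.le]; ring_nf
  have e6 : R ^ (p - 6) * (S * √S) = S ^ (3 * (p - 2) / 8) := by
    rw [hRdef, ← Real.rpow_mul hS.le, Real.sqrt_eq_rpow]
    nth_rewrite 2 [← Real.rpow_one S]
    rw [← Real.rpow_add hS, ← Real.rpow_add hS]
    ring_nf
  calc _ ≤ R ^ (p - 2) * B + R ^ (p - 6) * (64 * S * B * √(B * S)) := h1.trans (by gcongr)
    _ = R ^ (p - 2) * B + 64 * B * √B * (R ^ (p - 6) * (S * √S)) := by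
        rw [Real.sqrt_mul hB0]; ring
    _ = _ := by rw [e2, e6]; ring

end AnisotropicGagliardoNirenberg

/-- A priori bound on the anisotropic kinetic energy in the mass-subcritical regime. -/
theorem stmt_13 (p : ℝ) (hp1 : 2 < p) (hp2 : p < 14 / 3) :
    ∀ A : ℝ, ∀ B > (0 : ℝ), ∃ K > (0 : ℝ), ∀ u : SchwartzMap (ℝ × ℝ) ℂ,
      Ef p (fun z => u z) ≤ A → Mf (fun z => u z) ≤ B →
        Xf (fun z => u z) + Yf (fun z => u z) ≤ K := by
  intro A B hB
  have hσ : 0 < 1 - 3 * (p - 2) / 8 := by linarith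
  set C := B + 64 * B * √B
  have hC : 0 < C := by positivity
  obtain ⟨S₀, hS₀⟩ := Filter.eventually_atTop.1
    ((tendsto_rpow_atTop hσ).eventually_ge_atTop (4 * C))
  refine ⟨max S₀ (4 * |A|) + 1, by positivity, fun u hE hM => ?_⟩
  by_contra! hlt
  have hX0 : 0 ≤ Xf (fun z => u z) := integral_nonneg fun z => by positivity
  have hY0 : 0 ≤ Yf (fun z => u z) := integral_nonneg fun z => by positivity
  set S := Xf (fun z => u z) + Yf (fun z => u z) with hSdef
  have hS1 : S₀ ≤ S := by linarith [le_max_left S₀ (4 * |A|)]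
  have hS2 : 4 * |A| < S := by linarith [le_max_right S₀ (4 * |A|)]
  have hS : 0 < S := by linarith [abs_nonneg A]
  have hP := Pf_le_rpow (B := B) (S := S) hp1 (by linarith) hS u hM (by linarith) (by linarith)
  have hsplit : S ^ (1 - 3 * (p - 2) / 8) * S ^ (3 * (p - 2) / 8) = S := by
    rw [← Real.rpow_add hS, sub_add_cancel, Real.rpow_one]
  have hbig : 4 * C * S ^ (3 * (p - 2) / 8) ≤ S := by
    calc _ ≤ S ^ (1 - 3 * (p - 2) / 8) * S ^ (3 * (p - 2) / 8) := by
          gcongr; exact hS₀ S hS1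
      _ = S := hsplit
  have hP0 : 0 ≤ Pf p (fun z => u z) := integral_nonneg fun z => by positivity
  have hPp : Pf p (fun z => u z) / p ≤ Pf p (fun z => u z) := div_le_self hP0 (by linarith)
  have hE' : S / 2 - Pf p (fun z => u z) / p ≤ A := by
    calc _ = Ef p (fun z => u z) := by rw [Ef, hSdef]; ring
      _ ≤ A := hE
  linarith [le_abs_self A]
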